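/- Let B ⊆ ℂ^d be an open ball centered at the origin, let F, G : B → ℂ^g be holomorphic, and let τ : B → M_g(ℂ) be holomorphic with det(Im τ(0)) ≠ 0, satisfying ∂G/∂z_m(z) = τ(z)·∂F/∂z_m(z) for every m and z (but with no vanishing assumption on F(0), G(0)). If there is a sequence of points x_i ∈ B ∖ {0} converging to the origin with Im F(x_i) = 0 and Im G(x_i) = 0 for all i, then Im F(0) = 0, Im G(0) = 0, and there is a subsequence x_{i_k} along which F(x_{i_k}) = F(0) and G(x_{i_k}) = G(0) for all k; in particular F and G take the constant real values F(0) ∈ ℝ^g and G(0) ∈ ℝ^g along this subsequence. -/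

import Mathlib

open Metric Filter Matrix

section Helpers
open Topology

theorem fc_exists {ι : Type} [Fintype ι] [DecidableEq ι] (f : (ι → ℂ) → ℂ) (hf : AnalyticAt ℂ f 0) :
    ∃ r : ℝ, 0 < r ∧ ∀ (B : Type) [NormedCommRing B] [NormedAlgebra ℂ B] [CompleteSpace B]
      [NormOneClass B], ∃ F : (ι → B) → B, AnalyticOnNhd ℂ F (ball 0 r) ∧
        ∀ χ : B →ₐ[ℂ] ℂ, (∀ c, ‖χ c‖ ≤ ‖c‖) → ∀ b ∈ ball (0 : ι → B) r,
          χ (F b) = f (fun i => χ (b i)) := by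
  obtain ⟨p, R, hp⟩ := hf
  obtain ⟨R', hR'0, hR'⟩ := ENNReal.lt_iff_exists_nnreal_btwn.1 hp.r_pos
  have hR'0' : (0:ℝ) < R' := by exact_mod_cast hR'0
  set M : ℝ := Fintype.card ι + 1 with hM
  have hM1 : 1 ≤ M := by simp [hM]
  have hM0 : 0 < M := by linarith
  obtain ⟨C, hC0, hC⟩ := p.norm_mul_pow_le_of_lt_radius (lt_of_lt_of_le hR' hp.r_le)
  refine ⟨R' / M, by positivity, ?_⟩
  intro B _ _ _ _
  let P : FormalMultilinearSeries ℂ (ι → B) B := fun n =>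
    ∑ v : Fin n → ι, p n (fun i => Pi.single (v i) 1) •
      (ContinuousMultilinearMap.mkPiAlgebra ℂ (Fin n) B).compContinuousLinearMap
        (fun i => ContinuousLinearMap.proj (v i))
  have hPapp : ∀ n (b : ι → B), P n (fun _ => b) =
      ∑ v : Fin n → ι, p n (fun i => Pi.single (v i) 1) • ∏ i, b (v i) := by
    intro n b
    simp [P]
  have hPn : ∀ n, ‖P n‖ ≤ ‖p n‖ * M ^ n := by
    intro n
    calc ‖P n‖ ≤ ∑ v : Fin n → ι, ‖p n‖ := by
          refine norm_sum_le_of_le _ fun v _ => ?_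
          rw [norm_smul]
          have h1 : ‖p n (fun i => Pi.single (v i) 1)‖ ≤ ‖p n‖ := by
            refine (ContinuousMultilinearMap.le_opNorm _ _).trans ?_
            have : ∏ i : Fin n, ‖(Pi.single (v i) 1 : ι → ℂ)‖ = 1 := by
              apply Finset.prod_eq_one; intro i _
              rw [Pi.norm_single]; simp
            rw [this, mul_one]
          have h2 : ‖(ContinuousMultilinearMap.mkPiAlgebra ℂ (Fin n) B).compContinuousLinearMap
              (fun i => ContinuousLinearMap.proj (R := ℂ) (φ := fun _ : ι => B) (v i))‖ ≤ 1 := by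
            refine ContinuousMultilinearMap.opNorm_le_bound zero_le_one fun m => ?_
            simp only [ContinuousMultilinearMap.compContinuousLinearMap_apply,
              ContinuousMultilinearMap.mkPiAlgebra_apply, ContinuousLinearMap.proj_apply, one_mul]
            refine (Finset.norm_prod_le _ _).trans ?_
            exact Finset.prod_le_prod (fun _ _ => norm_nonneg _) fun i _ => norm_le_pi_norm _ _
          calc _ ≤ ‖p n‖ * 1 := mul_le_mul h1 h2 (norm_nonneg _) (norm_nonneg _)
            _ = _ := mul_one _
      _ = ‖p n‖ * (Fintype.card ι : ℝ) ^ n := by simp [mul_comm]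
      _ ≤ _ := by gcongr; simp [hM]
  have hrad : ENNReal.ofReal (R' / M) ≤ P.radius := by
    have := P.le_radius_of_bound (r := (R' / M).toNNReal) C (fun n => by
      rw [Real.coe_toNNReal _ (by positivity)]
      calc ‖P n‖ * (R' / M) ^ n ≤ ‖p n‖ * M ^ n * (R' / M) ^ n := by
            gcongr; exact hPn n
        _ = ‖p n‖ * R' ^ n := by
            rw [div_pow]; field_simp
        _ ≤ C := hC n)
    exact this
  have hpos : 0 < P.radius := lt_of_lt_of_le (by simp; positivity) hrad
  have hPs := P.hasFPowerSeriesOnBall hpos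
  have hsub : ball (0 : ι → B) (R' / M) ⊆ Metric.eball 0 P.radius := by
    rw [← Metric.eball_ofReal]
    exact Metric.eball_subset_eball hrad
  refine ⟨P.sum, fun b hb => hPs.analyticAt_of_mem (hsub hb), ?_⟩
  intro χ hχ b hb
  have hs := P.hasSum (hsub hb)
  let χ' : B →L[ℂ] ℂ := LinearMap.mkContinuous χ.toLinearMap 1 (fun c => by simpa using hχ c)
  have hs1 := hs.mapL χ'
  have hmem : (fun i => χ (b i)) ∈ Metric.eball (0 : ι → ℂ) R := by
    have h1 : ‖(fun i => χ (b i))‖ ≤ ‖b‖ := by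
      rw [pi_norm_le_iff_of_nonneg (norm_nonneg _)]
      intro i; exact (hχ _).trans (norm_le_pi_norm _ _)
    have h2 : ‖b‖ < R' / M := by simpa using hb
    have h3 : R' / M ≤ R' := div_le_self hR'0'.le hM1
    refine Metric.eball_subset_eball hR'.le ?_
    rw [Metric.eball_coe]
    simp; linarith
  have hs2 := hp.hasSum hmem
  rw [zero_add] at hs2
  refine HasSum.unique (f := fun n => χ' (P n fun _ => b)) hs1 ?_
  have hχ' : ∀ c, χ' c = χ c := fun c => rfl
  suffices hfun : (fun n => χ' (P n fun _ => b)) = fun n => p n (fun _ i => χ (b i)) by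
    rw [hfun]; exact hs2
  funext n
  rw [hχ', hPapp, map_sum]
  have : (fun i => χ (b i)) = ∑ j, χ (b j) • (Pi.single j (1:ℂ) : ι → ℂ) := by
    ext i; simp [Finset.sum_apply, Pi.single_apply]
  rw [this, ContinuousMultilinearMap.map_sum]
  refine Finset.sum_congr rfl fun v _ => ?_
  rw [ContinuousMultilinearMap.map_smul_univ]
  simp [map_prod, mul_comm]

/-- extension by zero of a function on the closed disc -/
noncomputable def dext {ρ : ℝ} (b : C(closedBall (0 : ℂ) ρ, ℂ)) : ℂ → ℂ :=
  Function.extend Subtype.val b 0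

theorem dext_apply {ρ : ℝ} (b : C(closedBall (0 : ℂ) ρ, ℂ)) (z : ℂ) (hz : z ∈ closedBall (0 : ℂ) ρ) :
    dext b z = b ⟨z, hz⟩ :=
  Subtype.val_injective.extend_apply b 0 ⟨z, hz⟩

theorem dext_continuousOn {ρ : ℝ} (b : C(closedBall (0 : ℂ) ρ, ℂ)) :
    ContinuousOn (dext b) (closedBall 0 ρ) := by
  rw [continuousOn_iff_continuous_domRestrict]
  have : (closedBall (0 : ℂ) ρ).domRestrict (dext b) = b := by
    ext z; exact dext_apply b z.1 z.2
  rw [this]; exact b.continuous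

/-- the disc algebra -/
noncomputable def discAlg (ρ : ℝ) : Subalgebra ℂ C(closedBall (0 : ℂ) ρ, ℂ) where
  carrier := {b | DifferentiableOn ℂ (dext b) (ball 0 ρ)}
  mul_mem' := by
    intro a b ha hb
    refine (DifferentiableOn.mul ha hb).congr fun z hz => ?_
    have hz' := ball_subset_closedBall hz
    simp [dext_apply _ z hz']
  add_mem' := by
    intro a b ha hb
    refine (DifferentiableOn.add ha hb).congr fun z hz => ?_
    have hz' := ball_subset_closedBall hz
    simp [dext_apply _ z hz']
  algebraMap_mem' := by
    intro c
    refine (differentiableOn_const c).congr fun z hz => ?_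
    have hz' := ball_subset_closedBall hz
    simp [dext_apply _ z hz', Algebra.algebraMap_eq_smul_one]

theorem discAlg_isClosed (ρ : ℝ) : IsClosed (discAlg ρ : Set C(closedBall (0 : ℂ) ρ, ℂ)) := by
  rw [← isSeqClosed_iff_isClosed]
  intro u b hu hb
  have h1 : TendstoUniformlyOn (fun n => dext (u n)) (dext b) atTop (ball 0 ρ) := by
    have h2 := ContinuousMap.tendsto_iff_tendstoUniformly.1 hb
    rw [Metric.tendstoUniformlyOn_iff]
    rw [Metric.tendstoUniformly_iff] at h2
    intro ε hε
    filter_upwards [h2 ε hε] with n hn z hz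
    have hz' := ball_subset_closedBall hz
    simpa [dext_apply _ z hz'] using hn ⟨z, hz'⟩
  exact h1.tendstoLocallyUniformlyOn.differentiableOn (Eventually.of_forall hu) isOpen_ball

instance (ρ : ℝ) : CompleteSpace (discAlg ρ) := (discAlg_isClosed ρ).completeSpace_coe

theorem discAlg_normOne (ρ : ℝ) (hρ : 0 < ρ) : NormOneClass (discAlg ρ) := by
  have : Nonempty (closedBall (0 : ℂ) ρ) := ⟨⟨0, by simp [hρ.le]⟩⟩
  exact ⟨(norm_one : ‖(1 : C(closedBall (0 : ℂ) ρ, ℂ))‖ = 1)⟩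

/-- evaluation -/
noncomputable def discEv {ρ : ℝ} (z : closedBall (0 : ℂ) ρ) : discAlg ρ →ₐ[ℂ] ℂ where
  toFun b := (b : C(closedBall (0 : ℂ) ρ, ℂ)) z
  map_one' := rfl
  map_mul' _ _ := rfl
  map_zero' := rfl
  map_add' _ _ := rfl
  commutes' c := by simp

theorem discEv_norm {ρ : ℝ} (z : closedBall (0 : ℂ) ρ) (b : discAlg ρ) : ‖discEv z b‖ ≤ ‖b‖ :=
  ContinuousMap.norm_coe_le_norm (b : C(closedBall (0 : ℂ) ρ, ℂ)) z

theorem discAlg_ext {ρ : ℝ} {a b : discAlg ρ} (h : ∀ z, discEv z a = discEv z b) : a = b :=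
  Subtype.ext (ContinuousMap.ext h)

theorem discAlg_exists {ρ : ℝ} (f : ℂ → ℂ) (hc : ContinuousOn f (closedBall 0 ρ))
    (hd : DifferentiableOn ℂ f (ball 0 ρ)) :
    ∃ b : discAlg ρ, ∀ z : closedBall (0 : ℂ) ρ, discEv z b = f z := by
  refine ⟨⟨⟨(closedBall 0 ρ).domRestrict f, continuousOn_iff_continuous_domRestrict.1 hc⟩, ?_⟩, fun z => rfl⟩
  refine hd.congr fun z hz => ?_
  rw [dext_apply _ z (ball_subset_closedBall hz)]
  rfl

/-- Continuous evaluation -/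
noncomputable def discEvL {ρ : ℝ} (z : closedBall (0 : ℂ) ρ) : discAlg ρ →L[ℂ] ℂ :=
  LinearMap.mkContinuous (discEv z).toLinearMap 1 (fun b => by
    rw [one_mul]; exact discEv_norm z b)

theorem discEvL_apply {ρ : ℝ} (z : closedBall (0 : ℂ) ρ) (b : discAlg ρ) :
    discEvL z b = discEv z b := rfl

theorem discAlg_shift {ρ : ℝ} (hρ : 0 < ρ) :
    ∃ S : discAlg ρ →L[ℂ] discAlg ρ, ∀ b (z : closedBall (0 : ℂ) ρ),
      discEv z b = discEv ⟨0, by simp [hρ.le]⟩ b + (z : ℂ) * discEv z (S b) := by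
  obtain ⟨T, hT⟩ := discAlg_exists (ρ := ρ) (fun z => z) continuousOn_id differentiableOn_id
  let z0 : closedBall (0 : ℂ) ρ := ⟨0, by simp [hρ.le]⟩
  let L : (ℂ × discAlg ρ) →L[ℂ] discAlg ρ :=
    (ContinuousLinearMap.toSpanSingleton ℂ (1 : discAlg ρ)).coprod (ContinuousLinearMap.mul ℂ (discAlg ρ) T)
  have hL : ∀ c b z, discEv z (L (c, b)) = c + z * discEv z b := by
    intro c b z
    simp [L, hT]
  have hinj : LinearMap.ker (L : (ℂ × discAlg ρ) →ₗ[ℂ] discAlg ρ) = ⊥ := by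
    rw [LinearMap.ker_eq_bot']
    rintro ⟨c, b⟩ h
    have h' : ∀ z : closedBall (0 : ℂ) ρ, c + z * discEv z b = 0 := fun z => by
      rw [← hL]; erw [h]; simp
    have hc : c = 0 := by
      have := h' z0
      rwa [show (z0 : ℂ) = 0 from rfl, zero_mul, add_zero] at this
    have hb1 : ∀ z : closedBall (0 : ℂ) ρ, (z : ℂ) ≠ 0 → discEv z b = 0 := fun z hz => by
      have := h' z
      rw [hc, zero_add] at this
      exact (mul_eq_zero.1 this).resolve_left hz
    have hd : Dense {z : closedBall (0 : ℂ) ρ | (z : ℂ) ≠ 0} := by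
      intro z
      by_cases hz : (z : ℂ) = 0
      · rw [Metric.mem_closure_iff]
        intro ε hε
        have hm : 0 < min ρ (ε / 2) := lt_min hρ (by linarith)
        refine ⟨⟨((min ρ (ε / 2) : ℝ) : ℂ), ?_⟩, ?_, ?_⟩
        · rw [mem_closedBall_zero_iff, Complex.norm_real, Real.norm_of_nonneg hm.le]
          exact min_le_left _ _
        · simpa using hm.ne'
        · rw [Subtype.dist_eq, hz, dist_comm, dist_zero_right, Complex.norm_real,
            Real.norm_of_nonneg hm.le]
          exact lt_of_le_of_lt (min_le_right _ _) (by linarith)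
      · exact subset_closure hz
    have hcont : Continuous fun z => discEv z b :=
      (b : C(closedBall (0 : ℂ) ρ, ℂ)).continuous
    have hb : b = 0 := by
      apply discAlg_ext
      intro z
      rw [map_zero]
      exact congrFun (hcont.ext_on hd continuous_const (fun z hz => hb1 z hz)) z
    rw [hc, hb]; rfl
  have hsurj : LinearMap.range (L : (ℂ × discAlg ρ) →ₗ[ℂ] discAlg ρ) = ⊤ := by
    rw [LinearMap.range_eq_top]
    intro b
    have hd0 : DifferentiableOn ℂ (dext b.1) (ball 0 ρ) := b.2
    have hat : DifferentiableAt ℂ (dext b.1) 0 :=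
      hd0.differentiableAt (ball_mem_nhds _ hρ)
    obtain ⟨q, hq⟩ := discAlg_exists (ρ := ρ) (dslope (dext b.1) 0)
      ((continuousOn_dslope (closedBall_mem_nhds _ hρ)).2 ⟨dext_continuousOn _, hat⟩)
      ((Complex.differentiableOn_dslope (ball_mem_nhds _ hρ)).2 hd0)
    refine ⟨(discEv z0 b, q), ?_⟩
    apply discAlg_ext
    intro z
    have e := hL (discEv z0 b) q z
    refine e.trans ?_
    rw [hq]
    have := sub_smul_dslope (dext b.1) 0 (z : ℂ)
    rw [sub_zero, smul_eq_mul] at this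
    rw [this, dext_apply _ _ z.2, dext_apply _ _ z0.2]
    show discEv z0 b + (discEv z b - discEv z0 b) = _
    ring
  let e := ContinuousLinearEquiv.ofBijective L hinj hsurj
  refine ⟨(ContinuousLinearMap.snd ℂ ℂ (discAlg ρ)).comp e.symm.toContinuousLinearMap, ?_⟩
  intro b z
  have h1 : ∀ z, discEv z b = (e.symm b).1 + z * discEv z (e.symm b).2 := by
    intro z
    rw [← hL]
    congr 1
    exact (e.apply_symm_apply b).symm
  have h2 : discEv z0 b = (e.symm b).1 := by simpa [z0] using h1 z0
  show _ = discEv z0 b + _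
  rw [h2]
  exact h1 z

theorem wd_core {B E : Type} [NormedCommRing B] [NormedAlgebra ℂ B] [CompleteSpace B]
    [NormedAddCommGroup E] [NormedSpace ℂ E] {ρ : ℝ}
    (ev : closedBall (0 : ℂ) ρ → B →ₐ[ℂ] ℂ)
    (hext : ∀ a b, (∀ z, ev z a = ev z b) → a = b)
    (c0 : B →L[ℂ] ℂ) (S : B →L[ℂ] B) (hS : ∀ b z, ev z b = c0 b + (z : ℂ) * ev z (S b))
    (T V : B) (hT : ∀ z, ev z T = z) (s : ℕ) (gx fx : E → B) (hgx : AnalyticAt ℂ gx 0)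
    (hfx : AnalyticAt ℂ fx 0) (hV : ∀ z, ev z V * ev z (gx 0) = (z : ℂ) ^ s) :
    ∃ q : E × ℂ → ℂ, AnalyticAt ℂ q 0 ∧ ∃ r : Fin s → E → ℂ, (∀ i, AnalyticAt ℂ (r i) 0) ∧
      ∀ᶠ y in 𝓝 (0 : E × ℂ), ∀ hz : y.2 ∈ closedBall (0 : ℂ) ρ,
        ev ⟨y.2, hz⟩ (fx y.1) = q y * ev ⟨y.2, hz⟩ (gx y.1) + ∑ i, r i y.1 * y.2 ^ (i : ℕ) := by
  have hSn : ∀ (n : ℕ) b z, ev z b = ∑ i : Fin n, c0 ((S ^ (i : ℕ)) b) * (z : ℂ) ^ (i : ℕ)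
      + (z : ℂ) ^ n * ev z ((S ^ n) b) := by
    intro n
    induction n with
    | zero => intro b z; simp
    | succ n ih =>
      intro b z
      rw [ih b z, Fin.sum_univ_castSucc, hS ((S ^ n) b) z, pow_succ' S n]
      simp only [Fin.val_castSucc, Fin.val_last]
      have : (S * S ^ n) b = S ((S ^ n) b) := rfl
      rw [this]
      ring
  let A : B →L[ℂ] B := (ContinuousLinearMap.mul ℂ B V).comp (S ^ s)
  let C : B →L[ℂ] B := ∑ i : Fin s,
    (c0.comp (S ^ (i : ℕ))).smulRight (T ^ (i : ℕ))
  let Φ : B →L[ℂ] (B →L[ℂ] B) :=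
    ((ContinuousLinearMap.compL ℂ B B B).flip A).comp (ContinuousLinearMap.mul ℂ B)
  let M : E → (B →L[ℂ] B) := fun x => Φ (gx x) + C
  have hMapp : ∀ x b z, ev z (M x b) = ev z V * ev z ((S ^ s) b) * ev z (gx x) +
      ∑ i : Fin s, c0 ((S ^ (i : ℕ)) b) * (z : ℂ) ^ (i : ℕ) := by
    intro x b z
    have : M x b = gx x * (V * (S ^ s) b) + ∑ i : Fin s, c0 ((S ^ (i : ℕ)) b) • T ^ (i : ℕ) := by
      simp [M, Φ, A, C]
    rw [this, map_add, map_mul, map_mul, map_sum]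
    simp only [map_smul, map_pow, hT, smul_eq_mul]
    ring
  have hM0 : M 0 = 1 := by
    ext b
    apply hext
    intro z
    rw [hMapp, one_apply_eq_self, hSn s b z, mul_right_comm, hV]
    ring
  have hMan : AnalyticAt ℂ M 0 := ((Φ.analyticAt _).comp hgx).add analyticAt_const
  have hinv : AnalyticAt ℂ (fun x => Ring.inverse (M x)) 0 := by
    have h1 : AnalyticAt ℂ (Ring.inverse : (B →L[ℂ] B) → _) (M 0) := by
      rw [hM0]; exact analyticAt_inverse (1 : (B →L[ℂ] B)ˣ)
    exact h1.comp hMan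
  have happ : ∀ {G : Type} [NormedAddCommGroup G] [NormedSpace ℂ G] {a : G → (B →L[ℂ] B)} {b : G → B}
      {x : G}, AnalyticAt ℂ a x → AnalyticAt ℂ b x → AnalyticAt ℂ (fun x => a x (b x)) x := by
    intro G _ _ a b x ha hb
    exact ((ContinuousLinearMap.id ℂ (B →L[ℂ] B)).analyticAt_bilinear (a x, b x)).comp
      (f := fun x => (a x, b x)) (ha.prod hb)
  let bx : E → B := fun x => Ring.inverse (M x) (fx x)
  have hbx : AnalyticAt ℂ bx 0 := happ hinv hfx
  let β : E → B := fun x => V * (S ^ s) (bx x)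
  have hβ : AnalyticAt ℂ β 0 := (A.analyticAt _).comp hbx
  have hz0 : (1 - (0 : E × ℂ).2 • S) = 1 := by
    ext b; simp
  let q : E × ℂ → ℂ := fun y => c0 (Ring.inverse (1 - y.2 • S) (β y.1))
  have hSan : AnalyticAt ℂ (fun y : E × ℂ => Ring.inverse (1 - y.2 • S)) 0 := by
    have h1 : AnalyticAt ℂ (Ring.inverse : (B →L[ℂ] B) → _) (1 - (0 : E × ℂ).2 • S) := by
      rw [hz0]
      exact analyticAt_inverse (1 : (B →L[ℂ] B)ˣ)
    exact AnalyticAt.comp (f := fun y : E × ℂ => 1 - y.2 • S) h1 (analyticAt_const.sub (analyticAt_snd.smul analyticAt_const))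
  have hq : AnalyticAt ℂ q 0 := by
    have h1 : AnalyticAt ℂ (fun y : E × ℂ => β y.1) 0 :=
      AnalyticAt.comp (f := fun y : E × ℂ => y.1) (g := β) hβ analyticAt_fst
    exact (c0.analyticAt _).comp (happ hSan h1)
  refine ⟨q, hq, fun i x => c0 ((S ^ (i : ℕ)) (bx x)), fun i =>
    ((c0.comp (S ^ (i : ℕ))).analyticAt _).comp hbx, ?_⟩
  have hu1 : ∀ᶠ y in 𝓝 (0 : E × ℂ), IsUnit (M y.1) := by
    have hc : ContinuousAt (fun y : E × ℂ => M y.1) 0 :=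
      ContinuousAt.comp (f := fun y : E × ℂ => y.1) (g := M) hMan.continuousAt continuousAt_fst
    refine hc.eventually (Units.isOpen.mem_nhds ?_)
    show IsUnit (M 0)
    rw [hM0]; exact isUnit_one
  have hu2 : ∀ᶠ y in 𝓝 (0 : E × ℂ), IsUnit (1 - y.2 • S) := by
    have hc : Continuous (fun y : E × ℂ => 1 - y.2 • S) := by fun_prop
    refine hc.continuousAt.eventually (Units.isOpen.mem_nhds ?_)
    show IsUnit (1 - (0 : E × ℂ).2 • S)
    rw [hz0]; exact isUnit_one
  filter_upwards [hu1, hu2] with y h1 h2 hz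
  have e1 : M y.1 (bx y.1) = fx y.1 := by
    have := congrArg (fun L : B →L[ℂ] B => L (fx y.1)) (Ring.mul_inverse_cancel _ h1)
    simpa using this
  have e2 : q y = ev ⟨y.2, hz⟩ (β y.1) := by
    set w := Ring.inverse (1 - y.2 • S) (β y.1) with hw
    have h3 : (1 - y.2 • S) w = β y.1 := by
      have := congrArg (fun L : B →L[ℂ] B => L (β y.1)) (Ring.mul_inverse_cancel _ h2)
      simpa using this
    rw [← h3]
    show c0 w = _
    have h4 := hS w ⟨y.2, hz⟩
    simp only [_root_.sub_apply, one_apply_eq_self,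
      _root_.smul_apply, map_sub, map_smul, smul_eq_mul]
    rw [h4]; ring
  rw [← e1, hMapp, e2]
  simp [β]

theorem wd_family {N : ℕ} (f : (Fin N → ℂ) × ℂ → ℂ) (hf : AnalyticAt ℂ f 0) :
    ∃ r : ℝ, 0 < r ∧ ∀ ρ, 0 < ρ → ρ < r → ∃ fx : (Fin N → ℂ) → discAlg ρ, AnalyticAt ℂ fx 0 ∧
      ∀ x, ‖x‖ < r → ∀ z, discEv z (fx x) = f (x, (z : ℂ)) := by
  let L : (Fin (N + 1) → ℂ) →L[ℂ] (Fin N → ℂ) × ℂ :=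
    (ContinuousLinearMap.pi fun i : Fin N => ContinuousLinearMap.proj (Fin.succ i)).prod
      (ContinuousLinearMap.proj 0)
  have hL : ∀ u, L u = (fun i => u (Fin.succ i), u 0) := fun u => rfl
  have hfL : AnalyticAt ℂ (fun u => f (L u)) 0 := by
    refine AnalyticAt.comp (g := f) (f := fun u => L u) ?_ (L.analyticAt _)
    rw [map_zero]; exact hf
  obtain ⟨r, hr, h⟩ := fc_exists _ hfL
  refine ⟨r, hr, fun ρ hρ hρr => ?_⟩
  have := discAlg_normOne ρ hρ
  obtain ⟨F, hF, hχ⟩ := h (discAlg ρ)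
  obtain ⟨T, hT⟩ := discAlg_exists (ρ := ρ) (fun z => z) continuousOn_id differentiableOn_id
  have hTn : ‖T‖ ≤ ρ := by
    have : ‖T.1‖ ≤ ρ := by
      rw [ContinuousMap.norm_le _ hρ.le]
      intro z
      have h1 : T.1 z = z := hT z
      rw [h1]; exact mem_closedBall_zero_iff.1 z.2
    exact this
  let c : (Fin N → ℂ) → (Fin (N + 1) → discAlg ρ) := fun x =>
    Fin.cons T (fun i => algebraMap ℂ (discAlg ρ) (x i))
  have hc : AnalyticAt ℂ c 0 := by
    refine AnalyticAt.pi fun i => ?_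
    refine Fin.cases ?_ (fun j => ?_) i
    · exact analyticAt_const
    · exact ((Algebra.linearMap ℂ (discAlg ρ)).toContinuousLinearMap.comp
        (ContinuousLinearMap.proj (R := ℂ) (φ := fun _ : Fin N => ℂ) j)).analyticAt _
  have hcm : ∀ x, ‖x‖ < r → c x ∈ ball (0 : Fin (N + 1) → discAlg ρ) r := by
    intro x hx
    rw [mem_ball_zero_iff, pi_norm_lt_iff hr]
    intro i
    refine Fin.cases ?_ (fun j => ?_) i
    · exact lt_of_le_of_lt hTn hρr
    · have : ‖algebraMap ℂ (discAlg ρ) (x j)‖ = ‖x j‖ := norm_algebraMap' _ _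
      show ‖algebraMap ℂ (discAlg ρ) (x j)‖ < r
      rw [this]
      exact lt_of_le_of_lt (norm_le_pi_norm _ _) hx
  refine ⟨fun x => F (c x), (hF (c 0) (hcm 0 (by simpa using hr))).comp hc, ?_⟩
  intro x hx z
  rw [hχ (discEv z) (discEv_norm z) (c x) (hcm x hx), hL]
  have e1 : (fun i : Fin N => discEv z (c x (Fin.succ i))) = x := by
    funext i
    show discEv z (algebraMap ℂ (discAlg ρ) (x i)) = x i
    rw [AlgHom.commutes]; rfl
  have e2 : discEv z (c x 0) = z := hT z
  rw [e1, e2]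

theorem wd {N : ℕ} (g : (Fin N → ℂ) × ℂ → ℂ) (hg : AnalyticAt ℂ g 0)
    (hg0 : ¬ ∀ᶠ t in 𝓝 (0 : ℂ), g (0, t) = 0) :
    ∃ s : ℕ, ∀ f : (Fin N → ℂ) × ℂ → ℂ, AnalyticAt ℂ f 0 →
      ∃ q : (Fin N → ℂ) × ℂ → ℂ, AnalyticAt ℂ q 0 ∧ ∃ r : Fin s → (Fin N → ℂ) → ℂ,
        (∀ i, AnalyticAt ℂ (r i) 0) ∧ ∀ᶠ y in 𝓝 (0 : (Fin N → ℂ) × ℂ),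
          f y = q y * g y + ∑ i, r i y.1 * y.2 ^ (i : ℕ) := by
  have hga : AnalyticAt ℂ (fun t : ℂ => g (0, t)) 0 :=
    AnalyticAt.comp (g := g) (f := fun t : ℂ => ((0 : Fin N → ℂ), t)) hg
      (analyticAt_const.prod analyticAt_id)
  obtain ⟨s, u, hu, hu0, hgu⟩ := hga.exists_eventuallyEq_pow_smul_nonzero_iff.2 hg0
  refine ⟨s, fun f hf => ?_⟩
  obtain ⟨r1, hr1, h1⟩ := wd_family g hg
  obtain ⟨r2, hr2, h2⟩ := wd_family f hf
  have hev : ∀ᶠ t in 𝓝 (0 : ℂ), AnalyticAt ℂ u t ∧ u t ≠ 0 ∧ g (0, t) = t ^ s * u t := by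
    filter_upwards [hu.eventually_analyticAt, hu.continuousAt.eventually_ne hu0, hgu] with t a b c
    exact ⟨a, b, by simpa using c⟩
  obtain ⟨r3, hr3, h3⟩ := Metric.eventually_nhds_iff_ball.1 hev
  set m := min r1 (min r2 r3) with hm
  have hm0 : 0 < m := lt_min hr1 (lt_min hr2 hr3)
  have hm1 : m ≤ r1 := min_le_left _ _
  have hm2 : m ≤ r2 := (min_le_right _ _).trans (min_le_left _ _)
  have hm3 : m ≤ r3 := (min_le_right _ _).trans (min_le_right _ _)
  obtain ⟨ρ, hρ, hρm⟩ : ∃ ρ, 0 < ρ ∧ ρ < m := ⟨m / 2, by positivity, by linarith⟩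
  obtain ⟨gx, hgx, hgxe⟩ := h1 ρ hρ (by linarith)
  obtain ⟨fx, hfx, hfxe⟩ := h2 ρ hρ (by linarith)
  have hsub : closedBall (0 : ℂ) ρ ⊆ ball 0 r3 := closedBall_subset_ball (by linarith)
  have hd : DifferentiableOn ℂ (fun t => (u t)⁻¹) (closedBall 0 ρ) := fun t ht =>
    ((h3 t (hsub ht)).1.differentiableAt.inv (h3 t (hsub ht)).2.1).differentiableWithinAt
  obtain ⟨V, hV⟩ := discAlg_exists (ρ := ρ) (fun t => (u t)⁻¹) hd.continuousOn
    (hd.mono ball_subset_closedBall)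
  obtain ⟨T, hT⟩ := discAlg_exists (ρ := ρ) (fun z => z) continuousOn_id differentiableOn_id
  obtain ⟨S, hS⟩ := discAlg_shift hρ
  obtain ⟨q, hq, r, hr, hfin⟩ := wd_core (B := discAlg ρ) (E := Fin N → ℂ) (ρ := ρ)
    (fun z => discEv z) (fun a b h => discAlg_ext h) (discEvL ⟨0, by simp [hρ.le]⟩) S hS T V hT s gx fx hgx hfx (by
      intro z
      rw [hV, hgxe 0 (by simpa using hr1), (h3 z (hsub z.2)).2.2]
      have := (h3 z (hsub z.2)).2.1
      field_simp)
  refine ⟨q, hq, r, hr, ?_⟩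
  have hball : ∀ᶠ y in 𝓝 (0 : (Fin N → ℂ) × ℂ), ‖y‖ < ρ := by
    have := Metric.ball_mem_nhds (0 : (Fin N → ℂ) × ℂ) hρ
    filter_upwards [this] with y hy
    simpa using hy
  filter_upwards [hfin, hball] with y hy hyb
  have hy1 : ‖y.1‖ < ρ := lt_of_le_of_lt (norm_fst_le y) hyb
  have hy2 : ‖y.2‖ < ρ := lt_of_le_of_lt (norm_snd_le y) hyb
  have := hy (by simpa using hy2.le)
  rw [hfxe _ (by linarith), hgxe _ (by linarith)] at this
  exact this

theorem lift_sqzero {A H B : Type} [CommRing A] [CommRing H] [CommRing B] [Algebra A H]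
    [Algebra.FormallySmooth A H] (π : B →+* H) (hπ : Function.Surjective π)
    (hk : ∀ r s, π r = 0 → π s = 0 → r * s = 0) (φ : A →+* B) (hφ : ∀ a, π (φ a) = algebraMap A H a) :
    ∃ ψ : H →+* B, (∀ x, π (ψ x) = x) ∧ ∀ a, ψ (algebraMap A H a) = φ a := by
  let := φ.toAlgebra
  let π' : B →ₐ[A] H := { π with commutes' := hφ }
  have hk' : IsNilpotent (RingHom.ker (π' : B →+* H)) := by
    refine ⟨2, ?_⟩
    rw [pow_two, Ideal.zero_eq_bot, eq_bot_iff, Ideal.mul_le]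
    intro r hr s hs
    rw [Ideal.mem_bot]
    exact hk r s hr hs
  let ψ := Algebra.FormallySmooth.liftOfSurjective (AlgHom.id A H) π' hπ hk'
  refine ⟨ψ, fun x => ?_, fun a => ?_⟩
  · exact Algebra.FormallySmooth.liftOfSurjective_apply (AlgHom.id A H) π' hπ hk' x
  · exact ψ.commutes a

theorem smooth_field {K H : Type} [Field K] [Field H] [Algebra K H] [CharZero K] :
    Algebra.FormallySmooth K H := by
  obtain ⟨s, hs⟩ := exists_isTranscendenceBasis K H
  have := hs.isAlgebraic_field
  exact Algebra.FormallySmooth.of_algebraicIndependent_of_isSeparable hs.1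

theorem extend_derivation {A H : Type} [CommRing A] [IsDomain A] [Field H] [CharZero H]
    [Algebra A H] [FaithfulSMul A H] (d : A → H) (h0 : d 0 = 0) (h1 : d 1 = 0)
    (hadd : ∀ a b, d (a + b) = d a + d b)
    (hmul : ∀ a b, d (a * b) = algebraMap A H a * d b + algebraMap A H b * d a) :
    ∃ D : Derivation ℤ H H, ∀ a, D (algebraMap A H a) = d a := by
  let := FractionRing.liftAlgebra A H
  have : IsScalarTower A (FractionRing A) H := FractionRing.isScalarTower_liftAlgebra A H
  have : CharZero (FractionRing A) :=
    (algebraMap (FractionRing A) H).charZero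
  have : Algebra.FormallySmooth A (FractionRing A) := .of_isLocalization (nonZeroDivisors A)
  have : Algebra.FormallySmooth (FractionRing A) H := smooth_field
  have : Algebra.FormallySmooth A H := .comp A (FractionRing A) H
  let φ : A →+* TrivSqZeroExt H H :=
    { toFun := fun a => TrivSqZeroExt.inl (algebraMap A H a) + TrivSqZeroExt.inr (d a)
      map_zero' := by ext <;> simp [h0]
      map_one' := by ext <;> simp [h1]
      map_add' := by intro a b; ext <;> simp [hadd]
      map_mul' := by
        intro a b; ext <;> simp [hmul, mul_comm] }
  let π : TrivSqZeroExt H H →+* H := (TrivSqZeroExt.fstHom H H H).toRingHom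
  have hπ : Function.Surjective π := fun x => ⟨TrivSqZeroExt.inl x, rfl⟩
  have hk : ∀ r s, π r = 0 → π s = 0 → r * s = 0 := by
    intro r s hr hs
    have hr' : r.fst = 0 := hr
    have hs' : s.fst = 0 := hs
    ext <;> simp [hr', hs']
  obtain ⟨ψ, hψ, hψa⟩ := lift_sqzero π hπ hk φ (fun a => by
    show (TrivSqZeroExt.inl (algebraMap A H a) + TrivSqZeroExt.inr (d a) : TrivSqZeroExt H H).fst = _
    simp)
  have hfst : ∀ x, (ψ x).fst = x := hψ
  refine ⟨Derivation.mk' (AddMonoidHom.toIntLinearMap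
    { toFun := fun x => (ψ x).snd, map_zero' := by simp, map_add' := by simp }) ?_, ?_⟩
  · intro a b
    simp [hfst, mul_comm]
  · intro a
    have := congrArg TrivSqZeroExt.snd (hψa a)
    have h2 : (ψ (algebraMap A H a)).snd = d a := by simpa [φ] using this
    exact h2

theorem const_of_alg {H : Type} [Field H] (κ : ℂ →+* H) (K : Subfield H) (c : H)
    (hc : IsAlgebraic K c) (𝒟 : Set (Derivation ℤ H H))
    (hDK : ∀ D ∈ 𝒟, ∀ k ∈ K, D k ∈ K)
    (hconst : ∀ k ∈ K, (∀ D ∈ 𝒟, D k = 0) → ∃ l, κ l = k)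
    (h : ∀ D ∈ 𝒟, D c = 0) : ∃ l, κ l = c := by
  have hi : IsIntegral K c := hc.isIntegral
  set P := minpoly K c with hP
  have hmonic : P.Monic := minpoly.monic hi
  have hroot : Polynomial.aeval c P = 0 := minpoly.aeval K c
  have key : ∀ D ∈ 𝒟, ∀ i, D (P.coeff i : H) = 0 := by
    intro D hD
    let Q : Polynomial K := ∑ i ∈ Finset.range P.natDegree,
      Polynomial.C (⟨D (P.coeff i : H), hDK D hD _ (P.coeff i).2⟩ : K) * Polynomial.X ^ i
    have hQc : ∀ i < P.natDegree, (Q.coeff i : H) = D (P.coeff i : H) := by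
      intro i hi
      simp only [Q, Polynomial.finsetSum_coeff, Polynomial.coeff_C_mul, Polynomial.coeff_X_pow]
      rw [Finset.sum_eq_single i]
      · simp
      · intro j _ hj; simp [Ne.symm hj]
      · intro hn; exact absurd (Finset.mem_range.2 hi) hn
    have hQdeg : Q.degree < P.degree := by
      rw [Polynomial.degree_eq_natDegree hmonic.ne_zero]
      refine lt_of_le_of_lt (Polynomial.degree_sum_le _ _) ?_
      rw [Finset.sup_lt_iff (by exact WithBot.bot_lt_coe _)]
      intro i hi
      refine lt_of_le_of_lt (Polynomial.degree_C_mul_X_pow_le _ _) ?_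
      exact_mod_cast Finset.mem_range.1 hi
    have hDpow : ∀ i : ℕ, D (c ^ i) = 0 := by
      intro i; rw [Derivation.leibniz_pow, h D hD]; simp
    have hQroot : Polynomial.aeval c Q = 0 := by
      have h1 : Polynomial.aeval c P = ∑ i ∈ Finset.range (P.natDegree + 1), (P.coeff i : H) * c ^ i := by
        rw [Polynomial.aeval_eq_sum_range]
        rfl
      have h2 : D (Polynomial.aeval c P) = ∑ i ∈ Finset.range P.natDegree, D (P.coeff i : H) * c ^ i := by
        rw [h1, map_sum, Finset.sum_range_succ]
        have hl : (P.coeff P.natDegree : H) = 1 := by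
          rw [hmonic.coeff_natDegree]; rfl
        rw [hl, one_mul, hDpow, add_zero]
        refine Finset.sum_congr rfl fun i _ => ?_
        rw [Derivation.leibniz, hDpow]
        simp [mul_comm]
      rw [hroot, map_zero] at h2
      simp only [Q, map_sum, map_mul, Polynomial.aeval_C, map_pow, Polynomial.aeval_X]
      exact h2.symm
    have hQ0 : Q = 0 := by
      by_contra hne
      exact absurd (minpoly.degree_le_of_ne_zero K c hne hQroot) (not_le.2 hQdeg)
    intro i
    rcases lt_trichotomy i P.natDegree with hlt | heq | hgt
    · rw [← hQc i hlt, hQ0]; simp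
    · rw [heq, hmonic.coeff_natDegree]
      exact D.map_one_eq_zero
    · rw [Polynomial.coeff_eq_zero_of_natDegree_lt hgt]
      exact map_zero D
  choose l hl using fun i => hconst (P.coeff i : H) (P.coeff i).2 (fun D hD => key D hD i)
  let _ : Algebra ℂ H := κ.toAlgebra
  have hcalg : IsAlgebraic ℂ c := by
    refine ⟨∑ i ∈ Finset.range (P.natDegree + 1), Polynomial.C (l i) * Polynomial.X ^ i, ?_, ?_⟩
    · intro h0
      have h1 := congrArg (fun q => Polynomial.coeff q P.natDegree) h0
      simp only [Polynomial.finsetSum_coeff, Polynomial.coeff_C_mul, Polynomial.coeff_X_pow] at h1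
      rw [Finset.sum_eq_single P.natDegree] at h1
      · simp at h1
        have h2 := hl P.natDegree
        rw [h1, map_zero, hmonic.coeff_natDegree] at h2
        exact zero_ne_one h2
      · intro j _ hj; simp [Ne.symm hj]
      · intro hn; simp at hn
    · simp only [map_sum, map_mul, Polynomial.aeval_C, map_pow, Polynomial.aeval_X]
      have h1 : Polynomial.aeval c P = ∑ i ∈ Finset.range (P.natDegree + 1), (P.coeff i : H) * c ^ i := by
        rw [Polynomial.aeval_eq_sum_range]
        rfl
      rw [← hroot, h1]
      refine Finset.sum_congr rfl fun i _ => ?_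
      congr 1
      exact hl i
  have hdeg := IsAlgClosed.degree_eq_one_of_irreducible ℂ (minpoly.irreducible hcalg.isIntegral)
  exact minpoly.mem_range_of_degree_eq_one ℂ c hdeg

/-- the hypercomplex numbers -/
abbrev HU (U : Ultrafilter ℕ) := Filter.Germ (U : Filter ℕ) ℂ

noncomputable def gev (U : Ultrafilter ℕ) {E : Type} (p : ℕ → E) (f : E → ℂ) : HU U :=
  ((fun n => f (p n) : ℕ → ℂ) : HU U)

noncomputable def gdv (U : Ultrafilter ℕ) {E : Type} [NormedAddCommGroup E] [NormedSpace ℂ E]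
    (p v : ℕ → E) (f : E → ℂ) : HU U :=
  ((fun n => fderiv ℂ f (p n) (v n) : ℕ → ℂ) : HU U)

def Concl (U : Ultrafilter ℕ) {E : Type} [NormedAddCommGroup E] [NormedSpace ℂ E]
    (p : ℕ → E) : Prop :=
  ∃ (Ω : Subfield (HU U)) (𝒟 : Set (Derivation ℤ (HU U) (HU U))),
    (∀ f, AnalyticAt ℂ f 0 → gev U p f ∈ Ω) ∧ (∀ c, IsAlgebraic Ω c → c ∈ Ω) ∧
    (∀ D ∈ 𝒟, ∃ v, ∀ f, AnalyticAt ℂ f 0 → D (gev U p f) = gdv U p v f) ∧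
    ∀ c ∈ Ω, (∀ D ∈ 𝒟, D c = 0) → ∃ l : ℂ, ((fun _ => l : ℕ → ℂ) : HU U) = c

theorem gev_congr {E : Type} [NormedAddCommGroup E] [NormedSpace ℂ E]
    {U : Ultrafilter ℕ} {p : ℕ → E} (hp : Tendsto p U (𝓝 0))
    {f g : E → ℂ} (h : f =ᶠ[𝓝 0] g) : gev U p f = gev U p g :=
  Germ.coe_eq.2 (hp.eventually h)

theorem gdv_congr {E : Type} [NormedAddCommGroup E] [NormedSpace ℂ E]
    {U : Ultrafilter ℕ} {p v : ℕ → E} (hp : Tendsto p U (𝓝 0))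
    {f g : E → ℂ} (h : f =ᶠ[𝓝 0] g) : gdv U p v f = gdv U p v g := by
  refine Germ.coe_eq.2 ?_
  filter_upwards [hp.eventually h.eventually_nhds] with n hn
  rw [Filter.EventuallyEq.fderiv_eq hn]

theorem gdv_add {E : Type} [NormedAddCommGroup E] [NormedSpace ℂ E]
    {U : Ultrafilter ℕ} {p v : ℕ → E} (hp : Tendsto p U (𝓝 0))
    {f g : E → ℂ} (hf : AnalyticAt ℂ f 0) (hg : AnalyticAt ℂ g 0) :
    gdv U p v (fun x => f x + g x) = gdv U p v f + gdv U p v g := by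
  refine Germ.coe_eq.2 ?_
  filter_upwards [hp.eventually hf.eventually_analyticAt, hp.eventually hg.eventually_analyticAt]
    with n h1 h2
  rw [fderiv_fun_add h1.differentiableAt h2.differentiableAt]
  rfl

theorem gdv_mul {E : Type} [NormedAddCommGroup E] [NormedSpace ℂ E]
    {U : Ultrafilter ℕ} {p v : ℕ → E} (hp : Tendsto p U (𝓝 0))
    {f g : E → ℂ} (hf : AnalyticAt ℂ f 0) (hg : AnalyticAt ℂ g 0) :
    gdv U p v (fun x => f x * g x) = gev U p f * gdv U p v g + gev U p g * gdv U p v f := by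
  refine Germ.coe_eq.2 ?_
  filter_upwards [hp.eventually hf.eventually_analyticAt, hp.eventually hg.eventually_analyticAt]
    with n h1 h2
  rw [fderiv_fun_mul h1.differentiableAt h2.differentiableAt]
  rfl

theorem gdv_const {E : Type} [NormedAddCommGroup E] [NormedSpace ℂ E]
    {U : Ultrafilter ℕ} {p v : ℕ → E} (c : ℂ) : gdv U p v (fun _ => c) = 0 := by
  refine Germ.coe_eq.2 (Eventually.of_forall fun n => ?_)
  simp

theorem gev_add {E : Type} {U : Ultrafilter ℕ} {p : ℕ → E} (f g : E → ℂ) :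
    gev U p (fun x => f x + g x) = gev U p f + gev U p g := rfl

theorem gev_mul {E : Type} {U : Ultrafilter ℕ} {p : ℕ → E} (f g : E → ℂ) :
    gev U p (fun x => f x * g x) = gev U p f * gev U p g := rfl

theorem Concl.transfer {U : Ultrafilter ℕ} {E E' : Type} [NormedAddCommGroup E] [NormedSpace ℂ E]
    [NormedAddCommGroup E'] [NormedSpace ℂ E'] (e : E ≃L[ℂ] E') (p : ℕ → E)
    (h : Concl U (fun n => e (p n))) : Concl U p := by
  obtain ⟨Ω, 𝒟, h1, h2, h3, h4⟩ := h
  have han : ∀ f : E → ℂ, AnalyticAt ℂ f 0 → AnalyticAt ℂ (fun y => f (e.symm y)) 0 := by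
    intro f hf
    refine AnalyticAt.comp (g := f) (f := fun y => e.symm y) ?_
      (e.symm.toContinuousLinearMap.analyticAt _)
    rw [map_zero]; exact hf
  have hev : ∀ f : E → ℂ, gev U (fun n => e (p n)) (fun y => f (e.symm y)) = gev U p f := by
    intro f; simp [gev]
  refine ⟨Ω, 𝒟, fun f hf => ?_, h2, fun D hD => ?_, h4⟩
  · rw [← hev]; exact h1 _ (han f hf)
  · obtain ⟨v, hv⟩ := h3 D hD
    refine ⟨fun n => e.symm (v n), fun f hf => ?_⟩
    rw [← hev, hv _ (han f hf)]
    have : ∀ x, fderiv ℂ (fun y => f (e.symm y)) x =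
        (fderiv ℂ f (e.symm x)).comp (e.symm : E' →L[ℂ] E) := fun x =>
      e.symm.comp_right_fderiv (f := f) (x := x)
    simp [gdv, this]

theorem wronsk_const {E : Type} [NormedAddCommGroup E] [NormedSpace ℂ E] (a b : E → ℂ)
    (ha : AnalyticAt ℂ a 0) (hb : AnalyticAt ℂ b 0) (hb0 : ¬ b =ᶠ[𝓝 0] 0)
    (h : ∀ v, ∀ᶠ x in 𝓝 0, b x * fderiv ℂ a x v - a x * fderiv ℂ b x v = 0) :
    ∃ l : ℂ, ∀ᶠ x in 𝓝 0, a x = l * b x := by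
  let _ : NormedSpace ℝ E := NormedSpace.restrictScalars ℝ ℂ E
  obtain ⟨r, hr, hball⟩ := Metric.eventually_nhds_iff_ball.1
    (ha.eventually_analyticAt.and hb.eventually_analyticAt)
  have hA : AnalyticOnNhd ℂ a (ball 0 r) := fun x hx => (hball x hx).1
  have hB : AnalyticOnNhd ℂ b (ball 0 r) := fun x hx => (hball x hx).2
  have hpre : IsPreconnected (ball (0 : E) r) := (convex_ball 0 r).isPreconnected
  have h0 : (0 : E) ∈ ball (0 : E) r := mem_ball_self hr
  have hw : ∀ v, ∀ x ∈ ball (0 : E) r, b x * fderiv ℂ a x v - a x * fderiv ℂ b x v = 0 := by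
    intro v
    have hAn : AnalyticOnNhd ℂ (fun x => b x * fderiv ℂ a x v - a x * fderiv ℂ b x v)
        (ball 0 r) := by
      intro x hx
      have h1 : AnalyticAt ℂ (fun x => fderiv ℂ a x v) x :=
        ((ContinuousLinearMap.apply ℂ ℂ v).analyticAt _).comp (hA x hx).fderiv
      have h2 : AnalyticAt ℂ (fun x => fderiv ℂ b x v) x :=
        ((ContinuousLinearMap.apply ℂ ℂ v).analyticAt _).comp (hB x hx).fderiv
      exact ((hB x hx).mul h1).sub ((hA x hx).mul h2)
    intro x hx
    exact hAn.eqOn_of_preconnected_of_eventuallyEq (g := fun _ => 0)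
      (fun x _ => analyticAt_const) hpre h0 (h v) hx
  obtain ⟨y, hy, hby⟩ : ∃ y ∈ ball (0 : E) r, b y ≠ 0 := by
    by_contra hcon
    push Not at hcon
    exact hb0 (by filter_upwards [ball_mem_nhds (0 : E) hr] with x hx using hcon x hx)
  have hnear : ∀ᶠ x in 𝓝 y, x ∈ ball (0 : E) r ∧ b x ≠ 0 :=
    Filter.Eventually.and (isOpen_ball.mem_nhds hy) ((hB y hy).continuousAt.eventually_ne hby)
  obtain ⟨s, hs, hsb⟩ := Metric.eventually_nhds_iff_ball.1 hnear
  have hd : ∀ x ∈ ball y s, HasFDerivAt (fun x => a x / b x) (0 : E →L[ℂ] ℂ) x := by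
    intro x hx
    obtain ⟨hx1, hx2⟩ := hsb x hx
    have h1 := (hA x hx1).differentiableAt.hasFDerivAt.mul
      ((hasDerivAt_inv hx2).comp_hasFDerivAt x (hB x hx1).differentiableAt.hasFDerivAt)
    have h2 : (fun x => a x / b x) = a * (Inv.inv ∘ b) := by
      ext x; simp [div_eq_mul_inv]
    rw [h2]
    refine h1.congr_fderiv (ContinuousLinearMap.ext fun v => ?_)
    have := hw v x hx1
    simp only [_root_.add_apply, _root_.smul_apply, smul_eq_mul, _root_.zero_apply,
      Function.comp_apply]
    field_simp
    linear_combination this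
  obtain ⟨l, hl⟩ := isOpen_ball.exists_is_const_of_fderiv_eq_zero (𝕜 := ℂ)
    (convex_ball y s).isPreconnected
    (fun x hx => (hd x hx).differentiableAt.differentiableWithinAt)
    (fun x hx => (hd x hx).fderiv)
  refine ⟨l, ?_⟩
  have := hA.eqOn_of_preconnected_of_eventuallyEq (g := fun x => l * b x)
    (fun x hx => analyticAt_const.mul (hB x hx)) hpre hy (by
      filter_upwards [ball_mem_nhds y hs] with x hx
      rw [← hl x hx, div_mul_cancel₀ _ (hsb x hx).2])
  filter_upwards [ball_mem_nhds (0 : E) hr] with x hx using this hx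

noncomputable def gkap (U : Ultrafilter ℕ) : ℂ →+* HU U :=
  (Germ.coeRingHom (U : Filter ℕ)).comp (Pi.constRingHom ℕ ℂ)

theorem charZero_HU (U : Ultrafilter ℕ) : CharZero (HU U) :=
  charZero_of_injective_ringHom (gkap U).injective

theorem Concl.base {U : Ultrafilter ℕ} {E : Type} [NormedAddCommGroup E] [NormedSpace ℂ E]
    (p : ℕ → E) (hp : Tendsto p U (𝓝 0))
    (hinj : ∀ f, AnalyticAt ℂ f 0 → gev U p f = 0 → f =ᶠ[𝓝 0] 0) : Concl U p := by
  have := charZero_HU U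
  let A : Subring (HU U) :=
    { carrier := {h | ∃ f, AnalyticAt ℂ f 0 ∧ gev U p f = h}
      mul_mem' := by
        rintro _ _ ⟨f, hf, rfl⟩ ⟨g, hg, rfl⟩
        exact ⟨_, hf.mul hg, rfl⟩
      one_mem' := ⟨fun _ => 1, analyticAt_const, rfl⟩
      add_mem' := by
        rintro _ _ ⟨f, hf, rfl⟩ ⟨g, hg, rfl⟩
        exact ⟨_, hf.add hg, rfl⟩
      zero_mem' := ⟨fun _ => 0, analyticAt_const, rfl⟩
      neg_mem' := by
        rintro _ ⟨f, hf, rfl⟩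
        exact ⟨_, hf.neg, rfl⟩ }
  have hfs : FaithfulSMul A (HU U) :=
    (faithfulSMul_iff_algebraMap_injective _ _).2 Subtype.val_injective
  have hinj2 : ∀ f g, AnalyticAt ℂ f 0 → AnalyticAt ℂ g 0 → gev U p f = gev U p g →
      f =ᶠ[𝓝 0] g := by
    intro f g hf hg h
    have h1 : gev U p (fun x => f x - g x) = 0 := by
      have : gev U p (fun x => f x - g x) = gev U p f - gev U p g := rfl
      rw [this, h, sub_self]
    filter_upwards [hinj _ (hf.sub hg) h1] with x hx
    exact sub_eq_zero.1 hx
  choose rep hrep1 hrep2 using fun a : A => a.2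
  have hrep : ∀ (v : ℕ → E) (a : A) f, AnalyticAt ℂ f 0 → gev U p f = a →
      gdv U p v (rep a) = gdv U p v f := by
    intro v a f hf h
    exact gdv_congr hp (hinj2 _ _ (hrep1 a) hf ((hrep2 a).trans h.symm))
  have hD : ∀ v : E, ∃ D : Derivation ℤ (HU U) (HU U), ∀ f, AnalyticAt ℂ f 0 →
      D (gev U p f) = gdv U p (fun _ => v) f := by
    intro v
    obtain ⟨D, hD⟩ := extend_derivation (A := A) (H := HU U)
      (fun a => gdv U p (fun _ => v) (rep a))
      (by
        rw [hrep _ 0 (fun _ => 0) analyticAt_const rfl]; exact gdv_const 0)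
      (by
        rw [hrep _ 1 (fun _ => 1) analyticAt_const rfl]; exact gdv_const 1)
      (by
        intro a b
        rw [hrep _ (a + b) (fun x => rep a x + rep b x) ((hrep1 a).add (hrep1 b))
          (by rw [gev_add, hrep2, hrep2]; rfl)]
        exact gdv_add hp (hrep1 a) (hrep1 b))
      (by
        intro a b
        rw [hrep _ (a * b) (fun x => rep a x * rep b x) ((hrep1 a).mul (hrep1 b))
          (by rw [gev_mul, hrep2, hrep2]; rfl)]
        rw [gdv_mul hp (hrep1 a) (hrep1 b), hrep2, hrep2]; rfl)
    refine ⟨D, fun f hf => ?_⟩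
    have h1 := hD ⟨gev U p f, f, hf, rfl⟩
    rw [hrep _ _ f hf rfl] at h1
    exact h1
  choose D hD using hD
  let K : Subfield (HU U) := Subfield.closure (A : Set (HU U))
  have hAK : ∀ f, AnalyticAt ℂ f 0 → gev U p f ∈ K := fun f hf =>
    Subfield.subset_closure ⟨f, hf, rfl⟩
  have hK : ∀ k ∈ K, ∃ a b, AnalyticAt ℂ a 0 ∧ AnalyticAt ℂ b 0 ∧ gev U p b ≠ 0 ∧
      k = gev U p a / gev U p b := by
    intro k hk
    obtain ⟨y, hy, z, hz, rfl⟩ := Subfield.mem_closure_iff.1 hk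
    rw [Subring.closure_eq] at hy hz
    obtain ⟨a, ha, rfl⟩ := hy
    obtain ⟨b, hb, rfl⟩ := hz
    by_cases h0 : gev U p b = 0
    · refine ⟨fun _ => 0, fun _ => 1, analyticAt_const, analyticAt_const, one_ne_zero (α := HU U), ?_⟩
      rw [h0, div_zero]
      exact (zero_div _).symm
    · exact ⟨a, b, ha, hb, h0, rfl⟩
  have hgd : ∀ (v : E) (f : E → ℂ), AnalyticAt ℂ f 0 → AnalyticAt ℂ (fun x => fderiv ℂ f x v) 0 := fun v f hf =>
    ((ContinuousLinearMap.apply ℂ ℂ v).analyticAt _).comp hf.fderiv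
  have hgdv : ∀ (v : E) (f : E → ℂ), gdv U p (fun _ => v) f = gev U p (fun x => fderiv ℂ f x v) := fun v f => rfl
  let 𝒟 := Set.range D
  have hDK : ∀ d ∈ 𝒟, ∀ k ∈ K, d k ∈ K := by
    rintro _ ⟨v, rfl⟩ k hk
    obtain ⟨a, b, ha, hb, -, rfl⟩ := hK k hk
    rw [Derivation.leibniz_div, hD v a ha, hD v b hb, hgdv, hgdv]
    simp only [smul_eq_mul]
    exact K.mul_mem (K.pow_mem (K.inv_mem (hAK b hb)) 2) (K.sub_mem
      (K.mul_mem (hAK b hb) (hAK _ (hgd v a ha))) (K.mul_mem (hAK a ha) (hAK _ (hgd v b hb))))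
  have hconst : ∀ k ∈ K, (∀ d ∈ 𝒟, d k = 0) → ∃ l, gkap U l = k := by
    intro k hk h
    obtain ⟨a, b, ha, hb, hb0, rfl⟩ := hK k hk
    obtain ⟨l, hl⟩ := wronsk_const a b ha hb
      (fun h => hb0 (by rw [gev_congr hp h]; rfl)) (by
        intro v
        have h1 := h _ ⟨v, rfl⟩
        rw [Derivation.leibniz_div, hD v a ha, hD v b hb, hgdv, hgdv, smul_eq_mul, mul_eq_zero] at h1
        have h2 := h1.resolve_left (pow_ne_zero _ (inv_ne_zero hb0))
        exact hinj (fun x => b x * fderiv ℂ a x v - a x * fderiv ℂ b x v)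
          ((hb.mul (hgd v a ha)).sub (ha.mul (hgd v b hb))) h2)
    refine ⟨l, ?_⟩
    rw [eq_div_iff hb0, gev_congr hp hl]
    rfl
  refine ⟨(algebraicClosure K (HU U)).toSubfield, 𝒟, fun f hf => ?_, fun c hc => ?_, ?_, ?_⟩
  · exact (algebraicClosure K (HU U)).algebraMap_mem ⟨_, hAK f hf⟩
  · have hc' : IsAlgebraic (algebraicClosure K (HU U)) c := hc
    have : Algebra.IsAlgebraic K (algebraicClosure K (HU U)) := algebraicClosure.isAlgebraic _ _
    exact (mem_algebraicClosure_iff).2 (hc'.restrictScalars K)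
  · rintro _ ⟨v, rfl⟩
    exact ⟨_, hD v⟩
  · intro c hc h
    exact const_of_alg (gkap U) K c (mem_algebraicClosure_iff.1 hc) 𝒟 hDK hconst h

theorem gev_sum {E : Type} {U : Ultrafilter ℕ} {p : ℕ → E} {ι : Type} (s : Finset ι)
    (f : ι → E → ℂ) : gev U p (fun x => ∑ i ∈ s, f i x) = ∑ i ∈ s, gev U p (f i) := by
  classical
  induction s using Finset.induction_on with
  | empty => simp only [Finset.sum_empty]; rfl
  | insert a s ha ih =>
    simp only [Finset.sum_insert ha]
    rw [gev_add, ih]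

theorem gev_pow {E : Type} {U : Ultrafilter ℕ} {p : ℕ → E} (f : E → ℂ) (k : ℕ) :
    gev U p (fun x => f x ^ k) = gev U p f ^ k := by
  induction k with
  | zero => simp only [pow_zero]; rfl
  | succ k ih => simp only [pow_succ]; rw [gev_mul, ih]

/-- compatibility of `D` with directional differentiation on `f`. -/
def Good (U : Ultrafilter ℕ) {E : Type} [NormedAddCommGroup E] [NormedSpace ℂ E]
    (p v : ℕ → E) (D : Derivation ℤ (HU U) (HU U)) (f : E → ℂ) : Prop :=
  AnalyticAt ℂ f 0 ∧ D (gev U p f) = gdv U p v f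

theorem Good.add {U : Ultrafilter ℕ} {E : Type} [NormedAddCommGroup E] [NormedSpace ℂ E]
    {p v : ℕ → E} {D : Derivation ℤ (HU U) (HU U)} (hp : Tendsto p U (𝓝 0)) {f g : E → ℂ}
    (hf : Good U p v D f) (hg : Good U p v D g) : Good U p v D (fun x => f x + g x) := by
  refine ⟨hf.1.add hg.1, ?_⟩
  rw [gev_add, map_add, hf.2, hg.2, gdv_add hp hf.1 hg.1]

theorem Good.mul {U : Ultrafilter ℕ} {E : Type} [NormedAddCommGroup E] [NormedSpace ℂ E]
    {p v : ℕ → E} {D : Derivation ℤ (HU U) (HU U)} (hp : Tendsto p U (𝓝 0)) {f g : E → ℂ}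
    (hf : Good U p v D f) (hg : Good U p v D g) : Good U p v D (fun x => f x * g x) := by
  refine ⟨hf.1.mul hg.1, ?_⟩
  rw [gev_mul, Derivation.leibniz, hf.2, hg.2, gdv_mul hp hf.1 hg.1]
  rfl

theorem Good.pow {U : Ultrafilter ℕ} {E : Type} [NormedAddCommGroup E] [NormedSpace ℂ E]
    {p v : ℕ → E} {D : Derivation ℤ (HU U) (HU U)} (hp : Tendsto p U (𝓝 0)) {f : E → ℂ}
    (hf : Good U p v D f) (k : ℕ) : Good U p v D (fun x => f x ^ k) := by
  induction k with
  | zero =>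
    simp only [pow_zero]
    refine ⟨analyticAt_const, ?_⟩
    rw [gdv_const]
    exact D.map_one_eq_zero
  | succ k ih => simp only [pow_succ]; exact ih.mul hp hf

theorem Good.sum {U : Ultrafilter ℕ} {E : Type} [NormedAddCommGroup E] [NormedSpace ℂ E]
    {p v : ℕ → E} {D : Derivation ℤ (HU U) (HU U)} (hp : Tendsto p U (𝓝 0)) {ι : Type}
    (s : Finset ι) {f : ι → E → ℂ}
    (hf : ∀ i, Good U p v D (f i)) : Good U p v D (fun x => ∑ i ∈ s, f i x) := by
  classical
  induction s using Finset.induction_on with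
  | empty =>
    simp only [Finset.sum_empty]
    refine ⟨analyticAt_const, ?_⟩
    rw [gdv_const]
    exact map_zero D
  | insert a s ha ih =>
    simp only [Finset.sum_insert ha]
    exact (hf a).add hp ih

theorem Concl.step {U : Ultrafilter ℕ} {N : ℕ} (p : ℕ → (Fin N → ℂ) × ℂ)
    (hp : Tendsto p U (𝓝 0)) (g : (Fin N → ℂ) × ℂ → ℂ) (hg : AnalyticAt ℂ g 0)
    (hgz : gev U p g = 0) (hg0 : ¬ ∀ᶠ t in 𝓝 (0 : ℂ), g (0, t) = 0)
    (hC : Concl U (fun n => (p n).1)) : Concl U p := by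
  obtain ⟨Ω, 𝒟, h1, h2, h3, h4⟩ := hC
  obtain ⟨s, hs⟩ := wd g hg hg0
  have hfst : ∀ r : (Fin N → ℂ) → ℂ, AnalyticAt ℂ r 0 →
      AnalyticAt ℂ (fun y : (Fin N → ℂ) × ℂ => r y.1) 0 := fun r hr =>
    AnalyticAt.comp (g := r) (f := fun y : (Fin N → ℂ) × ℂ => y.1) hr analyticAt_fst
  have hsnd : AnalyticAt ℂ (fun y : (Fin N → ℂ) × ℂ => y.2) 0 := analyticAt_snd
  obtain ⟨q, hq, r, hr, hqr⟩ := hs (fun y => y.2 ^ s) (hsnd.pow s)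
  set z := gev U p (fun y => y.2) with hz
  set W : (Fin N → ℂ) × ℂ → ℂ := fun y => y.2 ^ s + ∑ i, (fun x => -(r i x)) y.1 * y.2 ^ (i : ℕ)
    with hW
  have hWz : gev U p W = 0 := by
    have : W =ᶠ[𝓝 0] fun y => q y * g y := by
      filter_upwards [hqr] with y hy
      simp only [hW]
      rw [hy]
      simp [Finset.sum_neg_distrib]
    rw [gev_congr hp this, gev_mul, hgz, mul_zero]
  have hzΩ : z ∈ Ω := by
    apply h2
    refine ⟨Polynomial.X ^ s + ∑ i : Fin s, Polynomial.C
      (⟨_, h1 (fun x => -(r i x)) (hr i).neg⟩ : Ω) * Polynomial.X ^ (i : ℕ), ?_, ?_⟩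
    · exact (Polynomial.monic_X_pow_add (Polynomial.degree_sum_fin_lt _)).ne_zero
    · rw [← hWz, hW, gev_add, gev_sum, gev_pow]
      simp only [gev_mul, gev_pow, map_add, map_pow, map_sum, map_mul, Polynomial.aeval_X,
        Polynomial.aeval_C]
      rfl
  have hWan : AnalyticAt ℂ W 0 := by
    refine (hsnd.pow s).add ?_
    refine Finset.analyticAt_fun_sum _ fun i _ => ?_
    exact (hfst _ (hr i).neg).mul (hsnd.pow _)
  have hW0 : ¬ ∀ᶠ t in 𝓝 (0 : ℂ), W (0, t) = 0 := by
    intro h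
    have hne : (Polynomial.X ^ s + ∑ i : Fin s, Polynomial.C (-(r i 0)) *
      Polynomial.X ^ (i : ℕ) : Polynomial ℂ) ≠ 0 :=
      (Polynomial.monic_X_pow_add (Polynomial.degree_sum_fin_lt _)).ne_zero
    refine hne (Polynomial.eq_zero_of_infinite_isRoot _ ?_)
    refine (infinite_of_mem_nhds (0 : ℂ) h).mono fun t ht => ?_
    simpa [Polynomial.IsRoot, Polynomial.eval_finsetSum, hW] using ht
  obtain ⟨s', hs'⟩ := wd W hWan hW0
  refine ⟨Ω, 𝒟, fun f hf => ?_, h2, fun D hD => ?_, h4⟩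
  · obtain ⟨q', hq', r', hr', hqr'⟩ := hs' f hf
    rw [gev_congr hp hqr', gev_add, gev_mul, hWz, mul_zero, zero_add, gev_sum]
    refine Ω.sum_mem fun i _ => ?_
    rw [gev_mul, gev_pow]
    exact Ω.mul_mem (h1 _ (hr' i)) (Ω.pow_mem hzΩ _)
  · obtain ⟨v', hv'⟩ := h3 D hD
    obtain ⟨a, ha⟩ : ∃ a : ℕ → ℂ, (a : HU U) = D z := Quotient.exists_rep (D z)
    have hp1 : Tendsto (fun n => (p n).1) U (𝓝 0) := (continuous_fst.tendsto (0 : (Fin N → ℂ) × ℂ)).comp hp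
    refine ⟨fun n => (v' n, a n), ?_⟩
    have g1 : ∀ ρ : (Fin N → ℂ) → ℂ, AnalyticAt ℂ ρ 0 →
        Good U p (fun n => (v' n, a n)) D (fun y => ρ y.1) := by
      intro ρ hρ
      refine ⟨hfst ρ hρ, (hv' ρ hρ).trans ?_⟩
      refine Germ.coe_eq.2 ?_
      filter_upwards [hp1.eventually hρ.eventually_analyticAt] with n hn
      have := hn.differentiableAt.hasFDerivAt.comp (p n) hasFDerivAt_fst
      have e : (ρ ∘ Prod.fst) = fun y : (Fin N → ℂ) × ℂ => ρ y.1 := rfl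
      rw [e] at this
      rw [this.fderiv]
      rfl
    have g2 : Good U p (fun n => (v' n, a n)) D (fun y => y.2) := by
      refine ⟨hsnd, ha.symm.trans (Germ.coe_eq.2 (Eventually.of_forall fun n => ?_))⟩
      have : HasFDerivAt (𝕜 := ℂ) (fun y : (Fin N → ℂ) × ℂ => y.2) _ (p n) := hasFDerivAt_snd
      show a n = fderiv ℂ (fun y : (Fin N → ℂ) × ℂ => y.2) (p n) (v' n, a n)
      rw [this.fderiv]
      rfl
    have g3 : ∀ {m : ℕ} (r : Fin m → (Fin N → ℂ) → ℂ), (∀ i, AnalyticAt ℂ (r i) 0) →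
        Good U p (fun n => (v' n, a n)) D (fun y => ∑ i, r i y.1 * y.2 ^ (i : ℕ)) := by
      intro m r hr
      exact Good.sum hp _ fun i => (g1 _ (hr i)).mul hp (g2.pow hp _)
    have gW : Good U p (fun n => (v' n, a n)) D W :=
      (g2.pow hp s).add hp (g3 (fun i x => -(r i x)) fun i => (hr i).neg)
    intro f hf
    obtain ⟨q', hq', r', hr', hqr'⟩ := hs' f hf
    have hsum := g3 r' hr'
    rw [gev_congr hp hqr', gdv_congr hp hqr', gdv_add hp (f := fun x => q' x * W x) (hq'.mul hWan) hsum.1, gev_add, map_add,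
      hsum.2, gdv_mul hp hq' hWan, gev_mul, hWz, ← gW.2, hWz]
    simp

theorem exists_line {E : Type} [NormedAddCommGroup E] [NormedSpace ℂ E] (g : E → ℂ)
    (hg : AnalyticAt ℂ g 0) (hg0 : ¬ g =ᶠ[𝓝 0] 0) :
    ∃ e : E, ¬ ∀ᶠ t in 𝓝 (0 : ℂ), g (t • e) = 0 := by
  by_contra hcon
  push Not at hcon
  obtain ⟨r, hr, hball⟩ := Metric.eventually_nhds_iff_ball.1 hg.eventually_analyticAt
  apply hg0
  filter_upwards [ball_mem_nhds (0 : E) hr] with x hx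
  let L : ℂ →L[ℂ] E := (ContinuousLinearMap.id ℂ ℂ).smulRight x
  have hL : ∀ t, L t = t • x := fun t => by simp [L]
  let _ : NormedSpace ℝ E := NormedSpace.restrictScalars ℝ ℂ E
  have hS : IsPreconnected (L ⁻¹' ball (0 : E) r) := by
    have : L ⁻¹' ball (0 : E) r = (L.restrictScalars ℝ) ⁻¹' ball (0 : E) r := rfl
    rw [this]
    exact ((convex_ball (0 : E) r).linear_preimage
      (L.restrictScalars ℝ).toLinearMap).isPreconnected
  have hA : AnalyticOnNhd ℂ (fun t => g (L t)) (L ⁻¹' ball (0 : E) r) := fun t ht =>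
    AnalyticAt.comp (g := g) (f := L) (hball _ ht) (L.analyticAt t)
  have h0 : (0 : ℂ) ∈ L ⁻¹' ball (0 : E) r := by simpa using hr
  have h1 : (1 : ℂ) ∈ L ⁻¹' ball (0 : E) r := by
    rw [Set.mem_preimage, hL, one_smul]; exact hx
  have h2 := hA.eqOn_of_preconnected_of_eventuallyEq (g := fun _ => 0)
    (fun x _ => analyticAt_const) hS h0 (by
      filter_upwards [hcon x] with t ht
      rw [hL]; exact ht) h1
  simpa [hL] using h2

theorem Concl.all (U : Ultrafilter ℕ) (N : ℕ) : ∀ (E : Type) [NormedAddCommGroup E]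
    [NormedSpace ℂ E] [FiniteDimensional ℂ E], Module.finrank ℂ E = N →
    ∀ p : ℕ → E, Tendsto p U (𝓝 0) → Concl U p := by
  induction N with
  | zero =>
    intro E _ _ _ hN p hp
    have := Module.finrank_zero_iff.1 hN
    refine Concl.base p hp fun f hf h => ?_
    have h1 : ∀ᶠ n in (U : Filter ℕ), f (p n) = 0 := Germ.coe_eq.1 h
    obtain ⟨n, hn⟩ := h1.exists
    refine Eventually.of_forall fun x => ?_
    rw [Subsingleton.elim x (p n)]; exact hn
  | succ N ih =>
    intro E _ _ _ hN p hp
    by_cases hinj : ∀ f, AnalyticAt ℂ f 0 → gev U p f = 0 → f =ᶠ[𝓝 0] 0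
    · exact Concl.base p hp hinj
    push Not at hinj
    obtain ⟨g, hg, hgz, hg0⟩ := hinj
    obtain ⟨e, he⟩ := exists_line g hg hg0
    have hev : ∀ᶠ n in (U : Filter ℕ), g (p n) = 0 := Germ.coe_eq.1 hgz
    have hgzero : g 0 = 0 := by
      refine tendsto_nhds_unique (hg.continuousAt.tendsto.comp hp) ?_
      exact tendsto_const_nhds.congr' (by filter_upwards [hev] with n hn using hn.symm)
    have he0 : e ≠ 0 := by
      rintro rfl
      exact he (Eventually.of_forall fun t => by simpa using hgzero)
    let e0 : E ≃L[ℂ] (Fin N → ℂ) × ℂ := ContinuousLinearEquiv.ofFinrankEq (by simp [hN])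
    obtain ⟨A, hA⟩ := SeparatingDual.exists_continuousLinearEquiv_apply_eq (R := ℂ)
      (x := e0 e) (y := ((0 : Fin N → ℂ), (1 : ℂ))) (by simpa using he0) (by simp)
    let L := e0.trans A
    have hLe : L.symm (0, 1) = e := by
      rw [ContinuousLinearEquiv.symm_apply_eq]; exact hA.symm
    have hp' : Tendsto (fun n => L (p n)) U (𝓝 0) := by
      have := (L.continuous.tendsto 0).comp hp
      rwa [map_zero] at this
    refine Concl.transfer L p ?_
    refine Concl.step _ hp' (fun y => g (L.symm y)) ?_ ?_ ?_ ?_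
    · refine AnalyticAt.comp (g := g) (f := fun y => L.symm y) ?_
        (L.symm.toContinuousLinearMap.analyticAt _)
      rw [map_zero]; exact hg
    · rw [← hgz]; simp [gev]
    · intro h
      apply he
      filter_upwards [h] with t ht
      have : ((0 : Fin N → ℂ), t) = t • ((0 : Fin N → ℂ), (1 : ℂ)) := by simp
      rwa [this, map_smul, hLe] at ht
    · exact ih _ (by simp) _
        ((continuous_fst.tendsto (0 : (Fin N → ℂ) × ℂ)).comp hp')

noncomputable def starSeries {d : ℕ} (P : FormalMultilinearSeries ℂ (Fin d → ℂ) ℂ) :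
    FormalMultilinearSeries ℂ (Fin d → ℂ) ℂ := fun n =>
  MultilinearMap.mkContinuous
    { toFun := fun m => star (P n (fun i => star (m i)))
      map_update_add' := by
        intro _ m i x y
        have h : ∀ z, (fun j => star (Function.update m i z j)) =
            Function.update (fun j => star (m j)) i (star z) := by
          intro z; ext j k
          by_cases hj : j = i
          · subst hj; simp
          · simp [hj]
        simp only [h, star_add, ContinuousMultilinearMap.map_update_add]
      map_update_smul' := by
        intro _ m i c x
        have h : ∀ z, (fun j => star (Function.update m i z j)) =
            Function.update (fun j => star (m j)) i (star z) := by
          intro z; ext j k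
          by_cases hj : j = i
          · subst hj; simp
          · simp [hj]
        simp only [h, star_smul, ContinuousMultilinearMap.map_update_smul, smul_eq_mul, star_mul',
          star_star] } ‖P n‖ (by
      intro m
      refine (norm_star _).le.trans ?_
      refine ((P n).le_opNorm _).trans ?_
      simp [norm_star])

theorem analyticAt_star_star {d : ℕ} (f : (Fin d → ℂ) → ℂ) (hf : AnalyticAt ℂ f 0) :
    AnalyticAt ℂ (fun w => star (f (star w))) 0 := by
  obtain ⟨P, r, hP⟩ := hf
  refine ⟨starSeries P, r, ?_, hP.r_pos, ?_⟩
  · refine hP.r_le.trans (FormalMultilinearSeries.radius_le_of_le fun n => ?_)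
    exact MultilinearMap.mkContinuous_norm_le _ (norm_nonneg _) _
  · intro y hy
    have hy' : star y ∈ Metric.eball (0 : Fin d → ℂ) r := by
      simpa [Metric.mem_eball, edist_zero_right, enorm_eq_nnnorm] using hy
    have := (hP.hasSum hy').star
    simpa [starSeries] using this

theorem fderiv_star_star {d : ℕ} (f : (Fin d → ℂ) → ℂ) (z u : Fin d → ℂ)
    (hf : DifferentiableAt ℂ f z) :
    fderiv ℂ (fun w => star (f (star w))) (star z) u = star (fderiv ℂ f z (star u)) := by
  have := hf.hasFDerivAt.star_star
  have e : (star ∘ f ∘ star) = fun w => star (f (star w)) := rfl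
  rw [e] at this
  rw [this.fderiv]
  rfl

theorem im_linalg {g : ℕ} (T : Matrix (Fin g) (Fin g) ℂ) (hT : (T.map Complex.im).det ≠ 0)
    (a : Fin g → ℂ) (h : ∀ i, ∑ j, T i j * a j = ∑ j, star (T i j) * a j) : a = 0 := by
  refine Matrix.eq_zero_of_mulVec_eq_zero (M := (T.map Complex.im).map Complex.ofRealHom) ?_ ?_
  · rw [← RingHom.mapMatrix_apply, ← RingHom.map_det]
    simpa using hT
  · ext i
    have h1 : ∑ j, (T i j - star (T i j)) * a j = 0 := by
      simp only [sub_mul, Finset.sum_sub_distrib]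
      rw [h i, sub_self]
    have h2 : ∀ z : ℂ, z - star z = (2 * Complex.I) * (z.im : ℂ) := by
      intro z
      have := Complex.sub_conj z
      rw [Complex.star_def, this]; push_cast; ring
    simp only [h2, mul_assoc] at h1
    rw [← Finset.mul_sum, ← Finset.mul_sum] at h1
    simp only [mul_eq_zero, OfNat.ofNat_ne_zero, Complex.I_ne_zero, false_or] at h1
    simpa [Matrix.mulVec, dotProduct] using h1

end Helpers


/-- Final claim of Appendix A: dropping the vanishing of `F`, `G` at the origin, if
`Im F` and `Im G` vanish along a sequence of nonzero points tending to `0`, then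
`Im F(0) = 0`, `Im G(0) = 0`, and along a subsequence `F` and `G` take the constant
(real) values `F(0)` and `G(0)`. -/
theorem stmt_18 (d g : ℕ) (hd : 1 ≤ d) (hg : 1 ≤ g) (ρ : ℝ) (hρ : 0 < ρ)
    (F G : (Fin d → ℂ) → Fin g → ℂ)
    (τ : (Fin d → ℂ) → Matrix (Fin g) (Fin g) ℂ)
    (hF : AnalyticOnNhd ℂ F (ball 0 ρ)) (hG : AnalyticOnNhd ℂ G (ball 0 ρ))
    (hτ : ∀ i j : Fin g, AnalyticOnNhd ℂ (fun w => τ w i j) (ball 0 ρ))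
    (hdet : ((τ 0).map Complex.im).det ≠ 0)
    (hode : ∀ z ∈ ball (0 : Fin d → ℂ) ρ, ∀ m : Fin d,
      (fun i => fderiv ℂ (fun w => G w i) z (Pi.single m 1)) =
        (τ z).mulVec (fun j => fderiv ℂ (fun w => F w j) z (Pi.single m 1)))
    (x : ℕ → Fin d → ℂ) (hx : ∀ n, x n ∈ ball (0 : Fin d → ℂ) ρ)
    (hxne : ∀ n, x n ≠ 0) (hlim : Tendsto x atTop (nhds 0))
    (hImF : ∀ n, ∀ i, (F (x n) i).im = 0)
    (hImG : ∀ n, ∀ i, (G (x n) i).im = 0) :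
    (∀ i, (F 0 i).im = 0) ∧ (∀ i, (G 0 i).im = 0) ∧
      ∃ φ : ℕ → ℕ, StrictMono φ ∧
        ∀ k, F (x (φ k)) = F 0 ∧ G (x (φ k)) = G 0 := by
  classical
  have h00 : (0 : Fin d → ℂ) ∈ ball (0 : Fin d → ℂ) ρ := mem_ball_self hρ
  have hFi : ∀ i, ∀ z ∈ ball (0 : Fin d → ℂ) ρ, AnalyticAt ℂ (fun w => F w i) z := fun i z hz =>
    (analyticAt_pi_iff.1 (hF z hz)) i
  have hGi : ∀ i, ∀ z ∈ ball (0 : Fin d → ℂ) ρ, AnalyticAt ℂ (fun w => G w i) z := fun i z hz =>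
    (analyticAt_pi_iff.1 (hG z hz)) i
  -- limits at the origin are real
  have hreal : ∀ f : (Fin d → ℂ) → ℂ, AnalyticAt ℂ f 0 → (∀ n, (f (x n)).im = 0) →
      (f 0).im = 0 := by
    intro f hf him
    have h1 : Tendsto (fun n => (f (x n)).im) atTop (nhds (f 0).im) :=
      (Complex.continuous_im.tendsto _).comp (hf.continuousAt.tendsto.comp hlim)
    simp only [him] at h1
    exact (tendsto_nhds_unique h1 tendsto_const_nhds)
  refine ⟨fun i => hreal _ (hFi i 0 h00) (fun n => hImF n i),
    fun i => hreal _ (hGi i 0 h00) (fun n => hImG n i), ?_⟩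
  -- the chain rule for all directions
  have hode' : ∀ z ∈ ball (0 : Fin d → ℂ) ρ, ∀ u i, fderiv ℂ (fun w => G w i) z u =
      ∑ j, τ z i j * fderiv ℂ (fun w => F w j) z u := by
    intro z hz u i
    have : (fderiv ℂ (fun w => G w i) z : (Fin d → ℂ) →ₗ[ℂ] ℂ) =
        ∑ j, τ z i j • (fderiv ℂ (fun w => F w j) z : (Fin d → ℂ) →ₗ[ℂ] ℂ) := by
      refine (Pi.basisFun ℂ (Fin d)).ext fun m => ?_
      have h1 := congrFun (hode z hz m) i
      simp only [Matrix.mulVec, dotProduct] at h1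
      simpa [LinearMap.sum_apply] using h1
    have h2 := LinearMap.congr_fun this u
    simpa [LinearMap.sum_apply] using h2
  -- nondegeneracy near the origin
  have hdet' : ∀ᶠ z in nhds (0 : Fin d → ℂ), ((τ z).map Complex.im).det ≠ 0 := by
    have hc : ContinuousAt (fun z => ((τ z).map Complex.im).det) 0 := by
      have h1 : ContinuousAt (fun z => (τ z).map Complex.im) 0 := by
        refine continuousAt_pi.2 fun i => continuousAt_pi.2 fun j => ?_
        exact (Complex.continuous_im.continuousAt).comp (hτ i j 0 h00).continuousAt
      exact (Continuous.matrix_det continuous_id).continuousAt.comp h1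
    exact hc.eventually_ne hdet
  -- pass to the ultrapower
  let U : Ultrafilter ℕ := hyperfilter ℕ
  have hUle : (U : Filter ℕ) ≤ atTop := Nat.hyperfilter_le_atTop
  have hxU : Tendsto x U (nhds 0) := hlim.mono_left hUle
  let P : ℕ → (Fin d → ℂ) × (Fin d → ℂ) := fun n => (x n, star (x n))
  have hP : Tendsto P U (nhds 0) := by
    refine Tendsto.prodMk_nhds hxU ?_
    have := (continuous_star.tendsto (0 : Fin d → ℂ)).comp hxU
    rwa [star_zero] at this
  obtain ⟨Ω, 𝒟, h1, h2, h3, h4⟩ := Concl.all U _ _ rfl P hP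
  have han1 : ∀ f : (Fin d → ℂ) → ℂ, AnalyticAt ℂ f 0 →
      AnalyticAt ℂ (fun y : (Fin d → ℂ) × (Fin d → ℂ) => f y.1) 0 := fun f hf =>
    AnalyticAt.comp (g := f) (f := fun y : (Fin d → ℂ) × (Fin d → ℂ) => y.1) hf analyticAt_fst
  have han2 : ∀ f : (Fin d → ℂ) → ℂ, AnalyticAt ℂ f 0 →
      AnalyticAt ℂ (fun y : (Fin d → ℂ) × (Fin d → ℂ) => star (f (star y.2))) 0 := fun f hf =>
    AnalyticAt.comp (g := fun w => star (f (star w)))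
      (f := fun y : (Fin d → ℂ) × (Fin d → ℂ) => y.2) (analyticAt_star_star f hf) analyticAt_snd
  have hd1 : ∀ (f : (Fin d → ℂ) → ℂ) (n : ℕ) (u : (Fin d → ℂ) × (Fin d → ℂ)),
      AnalyticAt ℂ f (x n) →
      fderiv ℂ (fun y : (Fin d → ℂ) × (Fin d → ℂ) => f y.1) (P n) u = fderiv ℂ f (x n) u.1 := by
    intro f n u hf
    have h5 : HasFDerivAt f (fderiv ℂ f (x n)) (P n).1 := hf.differentiableAt.hasFDerivAt
    have := h5.comp (P n) hasFDerivAt_fst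
    have e : (f ∘ Prod.fst) = fun y : (Fin d → ℂ) × (Fin d → ℂ) => f y.1 := rfl
    rw [e] at this
    rw [this.fderiv]
    rfl
  have hd2 : ∀ (f : (Fin d → ℂ) → ℂ) (n : ℕ) (u : (Fin d → ℂ) × (Fin d → ℂ)),
      AnalyticAt ℂ f (x n) →
      fderiv ℂ (fun y : (Fin d → ℂ) × (Fin d → ℂ) => star (f (star y.2))) (P n) u =
        star (fderiv ℂ f (x n) (star u.2)) := by
    intro f n u hf
    rw [← fderiv_star_star f (x n) u.2 hf.differentiableAt]
    have h5 : DifferentiableAt ℂ (fun w => star (f (star w))) (star (x n)) :=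
      hf.differentiableAt.star_star
    have h6 : HasFDerivAt (fun w => star (f (star w)))
      (fderiv ℂ (fun w => star (f (star w))) (star (x n))) (P n).2 := h5.hasFDerivAt
    have := h6.comp (P n) hasFDerivAt_snd
    have e : ((fun w => star (f (star w))) ∘ Prod.snd) =
      fun y : (Fin d → ℂ) × (Fin d → ℂ) => star (f (star y.2)) := rfl
    rw [e] at this
    rw [this.fderiv]
    rfl
  -- real values along the sequence give a relation between the two halves
  have hrel : ∀ f : (Fin d → ℂ) → ℂ, (∀ z ∈ ball (0 : Fin d → ℂ) ρ, AnalyticAt ℂ f z) →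
      (∀ n, (f (x n)).im = 0) → ∀ D ∈ 𝒟, ∀ v : ℕ → (Fin d → ℂ) × (Fin d → ℂ),
      (∀ f, AnalyticAt ℂ f 0 → D (gev U P f) = gdv U P v f) →
      ∀ᶠ n in (U : Filter ℕ), fderiv ℂ f (x n) (v n).1 =
        star (fderiv ℂ f (x n) (star (v n).2)) := by
    intro f hf him D hD v hv
    have e1 : gev U P (fun y => f y.1) = gev U P (fun y => star (f (star y.2))) := by
      refine Germ.coe_eq.2 (Eventually.of_forall fun n => ?_)
      simp only [P, star_star]
      exact (Complex.conj_eq_iff_im.2 (him n)).symm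
    have e2 := congrArg D e1
    rw [hv _ (han1 f (hf 0 h00)), hv _ (han2 f (hf 0 h00))] at e2
    filter_upwards [Germ.coe_eq.1 e2] with n hn
    rwa [hd1 f n _ (hf _ (hx n)), hd2 f n _ (hf _ (hx n))] at hn
  have hkill : ∀ D ∈ 𝒟, ∀ v : ℕ → (Fin d → ℂ) × (Fin d → ℂ),
      (∀ f, AnalyticAt ℂ f 0 → D (gev U P f) = gdv U P v f) →
      ∀ᶠ n in (U : Filter ℕ), (fun j => fderiv ℂ (fun w => F w j) (x n) (v n).1) = 0 := by
    intro D hD v hv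
    have a1 : ∀ᶠ n in (U : Filter ℕ), ∀ j, fderiv ℂ (fun w => F w j) (x n) (v n).1 =
        star (fderiv ℂ (fun w => F w j) (x n) (star (v n).2)) :=
      eventually_all.2 fun j => hrel _ (hFi j) (fun n => hImF n j) D hD v hv
    have a2 : ∀ᶠ n in (U : Filter ℕ), ∀ j, fderiv ℂ (fun w => G w j) (x n) (v n).1 =
        star (fderiv ℂ (fun w => G w j) (x n) (star (v n).2)) :=
      eventually_all.2 fun j => hrel _ (hGi j) (fun n => hImG n j) D hD v hv
    filter_upwards [a1, a2, hxU.eventually hdet'] with n b1 b2 b3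
    refine im_linalg (τ (x n)) b3 _ fun i => ?_
    have b4 := b2 i
    rw [hode' _ (hx n), hode' _ (hx n), star_sum] at b4
    rw [b4]
    refine Finset.sum_congr rfl fun j _ => ?_
    rw [star_mul', b1 j]
  have hval : ∀ f : (Fin d → ℂ) → ℂ, AnalyticAt ℂ f 0 →
      (∀ D ∈ 𝒟, D (gev U P (fun y => f y.1)) = 0) → ∀ᶠ n in (U : Filter ℕ), f (x n) = f 0 := by
    intro f hf h
    obtain ⟨l, hl⟩ := h4 _ (h1 _ (han1 f hf)) h
    have c1 : ∀ᶠ n in (U : Filter ℕ), l = f (x n) := Germ.coe_eq.1 hl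
    have c2 : Tendsto (fun n => f (x n)) U (nhds (f 0)) := hf.continuousAt.tendsto.comp hxU
    have c3 : l = f 0 := tendsto_nhds_unique
      (tendsto_const_nhds.congr' c1) c2
    filter_upwards [c1] with n hn
    rw [← hn, c3]
  have hFv : ∀ᶠ n in (U : Filter ℕ), ∀ j, F (x n) j = F 0 j := by
    refine eventually_all.2 fun j => hval (fun w => F w j) (hFi j 0 h00) fun D hD => ?_
    obtain ⟨v, hv⟩ := h3 D hD
    rw [hv _ (han1 _ (hFi j 0 h00))]
    refine Germ.coe_eq.2 ?_
    filter_upwards [hkill D hD v hv] with n hn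
    rw [hd1 (fun w => F w j) n _ (hFi j _ (hx n))]
    exact congrFun hn j
  have hGv : ∀ᶠ n in (U : Filter ℕ), ∀ j, G (x n) j = G 0 j := by
    refine eventually_all.2 fun j => hval (fun w => G w j) (hGi j 0 h00) fun D hD => ?_
    obtain ⟨v, hv⟩ := h3 D hD
    rw [hv _ (han1 _ (hGi j 0 h00))]
    refine Germ.coe_eq.2 ?_
    filter_upwards [hkill D hD v hv] with n hn
    rw [hd1 (fun w => G w j) n _ (hGi j _ (hx n)), hode' _ (hx n)]
    have : ∀ k, fderiv ℂ (fun w => F w k) (x n) (v n).1 = 0 := fun k => congrFun hn k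
    simp [this]
  have hfreq : ∃ᶠ n in atTop, F (x n) = F 0 ∧ G (x n) = G 0 := by
    have : ∀ᶠ n in (U : Filter ℕ), F (x n) = F 0 ∧ G (x n) = G 0 := by
      filter_upwards [hFv, hGv] with n a b using ⟨funext a, funext b⟩
    exact this.frequently.filter_mono hUle
  exact extraction_of_frequently_atTop hfreq
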